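/- arXiv:1703.06336 — 2 statements merged into one kernel-verified Lean document; each statement's English description precedes it below -/
import Mathlib

section
/- For any fixed α ∈ (0,1) and any fixed δ > 0, there exists M such that for all m ≥ M: √((1−δ)·2·log m) ≤ z_{1−α/m} ≤ √(2·log m), where z_p denotes the p-quantile of the standard normal distribution N(0,1). -/
open MeasureTheory ProbabilityTheory Filter Real

/-- The `p`-quantile of a probability measure on `ℝ`. -/
noncomputable def quantile (μ : Measure ℝ) (p : ℝ) : ℝ :=
  sInf {x : ℝ | p ≤ (μ (Set.Iic x)).toReal}

/-- The `p`-quantile `z_p` of the standard normal distribution `N(0,1)`. -/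
noncomputable def normQuantile (p : ℝ) : ℝ := quantile (gaussianReal 0 1) p

/-- The Mills ratio upper bound for the tail of the standard normal distribution. -/
theorem gaussianReal_Ioi_le {t : ℝ} (ht : 0 < t) :
    (gaussianReal 0 1).real (Set.Ioi t) ≤ (√(2 * π))⁻¹ * exp (-t ^ 2 / 2) / t := by
  have hderiv : ∀ x ∈ Set.Ici t, HasDerivAt
      (fun x : ℝ => -((√(2 * π))⁻¹ * exp (-x ^ 2 / 2) / t))
      (x / t * gaussianPDFReal 0 1 x) x := by
    intro x _
    have h := ((((hasDerivAt_pow 2 x).neg.div_const 2).exp.const_mul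
      (√(2 * π))⁻¹).div_const t).neg
    refine h.congr_deriv ?_
    simp [gaussianPDFReal]
    ring
  have hnonneg : ∀ x ∈ Set.Ioi t, 0 ≤ x / t * gaussianPDFReal 0 1 x := fun x hx =>
    mul_nonneg (div_nonneg (ht.le.trans (le_of_lt hx)) ht.le) (gaussianPDFReal_nonneg 0 1 x)
  have hlim : Tendsto (fun x : ℝ => -((√(2 * π))⁻¹ * exp (-x ^ 2 / 2) / t)) atTop (nhds 0) := by
    have h1 : Tendsto (fun x : ℝ => -x ^ 2 / 2) atTop atBot := by
      simp only [neg_div]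
      exact tendsto_neg_atTop_atBot.comp
        ((tendsto_pow_atTop two_ne_zero).atTop_div_const two_pos)
    simpa using (((tendsto_exp_atBot.comp h1).const_mul (√(2 * π))⁻¹).div_const t).neg
  have hint := integrableOn_Ioi_deriv_of_nonneg' hderiv hnonneg hlim
  have heq := integral_Ioi_of_hasDerivAt_of_nonneg' hderiv hnonneg hlim
  rw [measureReal_def, gaussianReal_apply_eq_integral 0 one_ne_zero,
    ENNReal.toReal_ofReal (integral_nonneg fun x => gaussianPDFReal_nonneg 0 1 x)]
  calc ∫ x in Set.Ioi t, gaussianPDFReal 0 1 x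
      ≤ ∫ x in Set.Ioi t, x / t * gaussianPDFReal 0 1 x := by
        refine setIntegral_mono_on (integrable_gaussianPDFReal 0 1).integrableOn hint
          measurableSet_Ioi fun x hx => ?_
        exact le_mul_of_one_le_left (gaussianPDFReal_nonneg 0 1 x)
          ((one_le_div ht).2 (le_of_lt hx))
    _ = (√(2 * π))⁻¹ * exp (-t ^ 2 / 2) / t := by rw [heq]; ring

/-- The upper tail of the standard normal distribution at `t ≥ 0` is at least the density at
`t + 1`. -/
theorem le_gaussianReal_Ioi {t : ℝ} (ht : 0 ≤ t) :
    (√(2 * π))⁻¹ * exp (-(t + 1) ^ 2 / 2) ≤ (gaussianReal 0 1).real (Set.Ioi t) := by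
  refine le_trans ?_ (measureReal_mono (Set.Ioc_subset_Ioi_self : Set.Ioc t (t + 1) ⊆ Set.Ioi t))
  rw [measureReal_def, gaussianReal_apply_eq_integral 0 one_ne_zero,
    ENNReal.toReal_ofReal (integral_nonneg fun x => gaussianPDFReal_nonneg 0 1 x)]
  have h : ∀ x ∈ Set.Ioc t (t + 1),
      (√(2 * π))⁻¹ * exp (-(t + 1) ^ 2 / 2) ≤ gaussianPDFReal 0 1 x := by
    intro x hx
    simp only [gaussianPDFReal, NNReal.coe_one, mul_one, sub_zero]
    have : x ^ 2 ≤ (t + 1) ^ 2 := pow_le_pow_left₀ (ht.trans hx.1.le) hx.2 2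
    gcongr
  simpa using setIntegral_ge_of_const_le_real measurableSet_Ioc (by simp) h
    (integrable_gaussianPDFReal 0 1).integrableOn

/-- A `p`-quantile is at least `s` and at most `t` if the distribution function is below `p` at `s`
and at least `p` at `t`. -/
theorem quantile_mem_Icc {μ : Measure ℝ} [IsFiniteMeasure μ] {p s t : ℝ}
    (hs : μ.real (Set.Iic s) < p) (ht : p ≤ μ.real (Set.Iic t)) :
    quantile μ p ∈ Set.Icc s t := by
  have hlower : ∀ x ∈ {x : ℝ | p ≤ (μ (Set.Iic x)).toReal}, s ≤ x := by
    intro x hx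
    by_contra! hlt
    exact absurd (hs.trans_le hx) (not_lt.2 (measureReal_mono (Set.Iic_subset_Iic.2 hlt.le)))
  exact ⟨le_csInf ⟨t, ht⟩ hlower, csInf_le ⟨s, hlower⟩ ht⟩

theorem measureReal_Iic_eq_one_sub (μ : Measure ℝ) [IsProbabilityMeasure μ] (x : ℝ) :
    μ.real (Set.Iic x) = 1 - μ.real (Set.Ioi x) := by
  rw [← Set.compl_Ioi, probReal_compl_eq_one_sub measurableSet_Ioi]

theorem eventually_sq_mul_add_one_add_lt_sq {c : ℝ} (hc : 0 ≤ c) (hc1 : c < 1) (K : ℝ) :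
    ∀ᶠ u : ℝ in atTop, (c * u + 1) ^ 2 + K < u ^ 2 := by
  have hd : 0 < 1 - c := sub_pos.2 hc1
  filter_upwards [eventually_ge_atTop 1, eventually_gt_atTop ((3 + |K|) / (1 - c))] with u hu hu'
  rw [div_lt_iff₀ hd] at hu'
  nlinarith [le_abs_self K, abs_nonneg K, mul_nonneg hc (zero_le_one.trans hu),
    mul_nonneg (mul_nonneg hc hd.le) (sq_nonneg u)]

/-- for any fixed `α ∈ (0,1)` and `δ > 0`, there exists `M` such that for
all `m ≥ M`, `√((1-δ)·2·log m) ≤ z_{1-α/m} ≤ √(2·log m)`. -/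
theorem normal_quantile_bounds
    (α δ : ℝ) (hα : α ∈ Set.Ioo (0 : ℝ) 1) (hδ : 0 < δ) :
    ∃ M : ℕ, ∀ m : ℕ, M ≤ m →
      Real.sqrt ((1 - δ) * (2 * Real.log m)) ≤ normQuantile (1 - α / m) ∧
      normQuantile (1 - α / m) ≤ Real.sqrt (2 * Real.log m) := by
  obtain ⟨hα0, hα1⟩ := hα
  have hlog : Tendsto (fun m : ℕ => √(2 * log m)) atTop atTop :=
    tendsto_sqrt_atTop.comp
      ((tendsto_log_atTop.comp tendsto_natCast_atTop_atTop).const_mul_atTop two_pos)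
  have hc1 : √(1 - δ) < 1 := by
    rw [sqrt_lt' one_pos]
    linarith
  have hpi : 0 < √(2 * π) := by positivity
  refine eventually_atTop.1 ?_
  filter_upwards [eventually_ge_atTop 1, hlog.eventually_gt_atTop 0,
    hlog.eventually_ge_atTop ((√(2 * π))⁻¹ / α),
    hlog.eventually (eventually_sq_mul_add_one_add_lt_sq (sqrt_nonneg _) hc1 (2 * log √(2 * π)))]
    with m hm hu hupper hlower
  have hm0 : (0 : ℝ) < m := by exact_mod_cast hm
  have hL : 0 ≤ 2 * log m := (sqrt_pos.1 hu).le
  have hsq : √(2 * log m) ^ 2 = 2 * log m := sq_sqrt hL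
  rw [sqrt_mul' _ hL]
  refine quantile_mem_Icc ?_ ?_ <;> rw [measureReal_Iic_eq_one_sub]
  · refine sub_lt_sub_left (lt_of_lt_of_le ?_ (le_gaussianReal_Ioi (by positivity))) 1
    calc α / m < 1 / m := by gcongr
      _ = exp (-log m) := by rw [exp_neg, exp_log hm0, one_div]
      _ ≤ exp (-log √(2 * π) + -(√(1 - δ) * √(2 * log m) + 1) ^ 2 / 2) := by
        apply exp_le_exp.2
        linarith
      _ = _ := by rw [exp_add, exp_neg, exp_log hpi]
  · refine sub_le_sub_left ((gaussianReal_Ioi_le hu).trans ?_) 1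
    have hexp : exp (-√(2 * log m) ^ 2 / 2) = (m : ℝ)⁻¹ := by
      rw [hsq, show -(2 * log m) / 2 = -log m by ring, exp_neg, exp_log hm0]
    rw [div_le_iff₀ hα0] at hupper
    rw [hexp, div_le_iff₀ hu, div_eq_mul_inv, mul_right_comm]
    gcongr
    linarith
end

section
/- Fix α ∈ (0,1) and δ > 0. Then there exists M such that for all m ≥ M and every integer n ≥ 2: (i) t_{n−1}(1 − α/m) ≥ √(n−1)·(exp((1−δ)·2·log(m)/(n−1)) − 1)^{1/2}, and (ii) t_{n−1}(1 − α/m) ≤ √(n−1)·(exp(2·log(m)/(n−1.5)) − 1)^{1/2}. -/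
open MeasureTheory ProbabilityTheory Filter Real

/-- Student's t distribution with `ν` degrees of freedom, defined through its density. -/
noncomputable def studentTMeasure (ν : ℝ) : Measure ℝ :=
  MeasureTheory.volume.withDensity fun x => ENNReal.ofReal
    (Real.Gamma ((ν + 1) / 2) / (Real.sqrt (ν * Real.pi) * Real.Gamma (ν / 2)) *
      (1 + x ^ 2 / ν) ^ (-((ν + 1) / 2)))

/-- The `p`-quantile of Student's t distribution with `ν` degrees of freedom. -/
noncomputable def tQuantile (ν : ℕ) (p : ℝ) : ℝ := quantile (studentTMeasure ν) p

theorem integrable_one_add_sq_rpow_neg {a : ℝ} (ha : 1 / 2 < a) :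
    Integrable fun x : ℝ => (1 + x ^ 2) ^ (-a) := by
  have h := integrable_rpow_neg_one_add_norm_sq (E := ℝ) (μ := volume) (r := 2 * a)
    (by simp; linarith)
  refine h.congr (Eventually.of_forall fun x => ?_)
  simp only [Real.norm_eq_abs, sq_abs]
  congr 1
  ring

theorem tendsto_mul_one_add_sq_rpow_neg {a : ℝ} (ha : 1 ≤ a) {l : Filter ℝ}
    (hl : Tendsto (fun x : ℝ => x⁻¹) l (nhds 0)) (hl0 : ∀ᶠ x in l, x ≠ 0) :
    Tendsto (fun x : ℝ => x * (1 + x ^ 2) ^ (-a)) l (nhds 0) := by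
  refine squeeze_zero_norm' ?_ (tendsto_zero_iff_norm_tendsto_zero.mp hl)
  filter_upwards [hl0] with x hx
  have h1 : (1 + x ^ 2) ^ (-a) ≤ (1 + x ^ 2) ^ (-1 : ℝ) :=
    rpow_le_rpow_of_exponent_le (by nlinarith [sq_nonneg x]) (by linarith)
  have h2 : (0 : ℝ) ≤ (1 + x ^ 2) ^ (-a) := by positivity
  have hx' : 0 < |x| := abs_pos.mpr hx
  rw [norm_mul, norm_inv, Real.norm_eq_abs, Real.norm_eq_abs, abs_of_nonneg h2]
  calc |x| * (1 + x ^ 2) ^ (-a) ≤ |x| * (1 + x ^ 2)⁻¹ := by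
        rw [← rpow_neg_one]; gcongr
    _ ≤ |x|⁻¹ := by
        rw [← sq_abs x, ← div_eq_mul_inv, inv_eq_one_div, div_le_div_iff₀ (by positivity) hx']
        nlinarith

theorem hasDerivAt_mul_one_add_sq_rpow_neg (a x : ℝ) :
    HasDerivAt (fun x : ℝ => x * (1 + x ^ 2) ^ (-a))
      ((1 - 2 * a) * (1 + x ^ 2) ^ (-a) + 2 * a * (1 + x ^ 2) ^ (-(a + 1))) x := by
  have hp : (0 : ℝ) < 1 + x ^ 2 := by positivity
  have h := (hasDerivAt_id x).mul
    ((((hasDerivAt_id x).pow 2).const_add 1).rpow_const (p := -a) (Or.inl (by simpa using hp.ne')))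
  convert! h using 1
  have e : (1 + x ^ 2) ^ (-a) = (1 + x ^ 2) ^ (-(a + 1)) * (1 + x ^ 2) := by
    rw [← rpow_add_one hp.ne']; congr 1; ring
  have e2 : (-a - 1 : ℝ) = -(a + 1) := by ring
  simp [e2, -neg_add_rev]
  rw [e]
  ring

theorem integral_one_add_sq_rpow_neg_add_one {a : ℝ} (ha : 1 ≤ a) :
    ∫ x : ℝ, (1 + x ^ 2) ^ (-(a + 1)) =
      (2 * a - 1) / (2 * a) * ∫ x : ℝ, (1 + x ^ 2) ^ (-a) := by
  have i1 := (integrable_one_add_sq_rpow_neg (a := a) (by linarith)).const_mul (1 - 2 * a)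
  have i2 := (integrable_one_add_sq_rpow_neg (a := a + 1) (by linarith)).const_mul (2 * a)
  have h := integral_of_hasDerivAt_of_tendsto (hasDerivAt_mul_one_add_sq_rpow_neg a) (i1.add i2)
    (tendsto_mul_one_add_sq_rpow_neg ha tendsto_inv_atBot_zero (eventually_ne_atBot 0))
    (tendsto_mul_one_add_sq_rpow_neg ha tendsto_inv_atTop_zero (eventually_ne_atTop 0))
  rw [integral_add i1 i2, integral_const_mul, integral_const_mul] at h
  field_simp
  linarith

theorem tendsto_mul_one_add_sq_rpow_neg_half :
    Tendsto (fun x : ℝ => x * (1 + x ^ 2) ^ (-(1 / 2) : ℝ)) atTop (nhds 1) := by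
  have h : Tendsto (fun x : ℝ => (1 + x⁻¹ ^ 2) ^ (-(1 / 2) : ℝ)) atTop
      (nhds ((1 + 0 ^ 2) ^ (-(1 / 2) : ℝ))) :=
    ((tendsto_inv_atTop_zero.pow 2).const_add 1).rpow_const (Or.inl (by norm_num))
  simp only [ne_eq, OfNat.ofNat_ne_zero, not_false_eq_true, zero_pow, add_zero, one_rpow] at h
  refine h.congr' ?_
  filter_upwards [eventually_gt_atTop 0] with x hx
  have e : 1 + x ^ 2 = x ^ 2 * (1 + x⁻¹ ^ 2) := by field_simp; ring
  have e2 : (x ^ 2) ^ (-(1 / 2) : ℝ) = x⁻¹ := by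
    rw [← rpow_natCast, ← rpow_mul hx.le, ← rpow_neg_one]; norm_num
  rw [e, mul_rpow (by positivity) (by positivity), e2]
  field_simp

theorem integral_one_add_sq_rpow_neg_three_halves :
    ∫ x : ℝ, (1 + x ^ 2) ^ (-(3 / 2) : ℝ) = 2 := by
  have hd : ∀ x : ℝ, HasDerivAt (fun x : ℝ => x * (1 + x ^ 2) ^ (-(1 / 2) : ℝ))
      ((1 + x ^ 2) ^ (-(3 / 2) : ℝ)) x := by
    intro x
    have h := hasDerivAt_mul_one_add_sq_rpow_neg (1 / 2) x
    norm_num at h ⊢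
    exact h
  have hbot : Tendsto (fun x : ℝ => x * (1 + x ^ 2) ^ (-(1 / 2) : ℝ)) atBot (nhds (-1)) := by
    have h := (tendsto_mul_one_add_sq_rpow_neg_half.comp tendsto_neg_atBot_atTop).neg
    refine h.congr fun x => ?_
    simp
  rw [integral_of_hasDerivAt_of_tendsto hd (integrable_one_add_sq_rpow_neg (by norm_num)) hbot
    tendsto_mul_one_add_sq_rpow_neg_half]
  norm_num

theorem integral_one_add_sq_rpow_neg_nat (k : ℕ) :
    ∫ x : ℝ, (1 + x ^ 2) ^ (-(((k : ℝ) + 2) / 2)) =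
      √π * Gamma (((k : ℝ) + 1) / 2) / Gamma (((k : ℝ) + 2) / 2) := by
  induction k using Nat.twoStepInduction with
  | zero =>
    have : ∀ x : ℝ, (1 + x ^ 2) ^ (-1 : ℝ) = (1 + x ^ 2)⁻¹ := fun x => rpow_neg_one _
    norm_num [this, Gamma_one_half_eq, mul_self_sqrt pi_pos.le]
  | one =>
    have h : Gamma (3 / 2) = 1 / 2 * √π := by
      rw [show (3 / 2 : ℝ) = 1 / 2 + 1 by norm_num, Gamma_add_one (by norm_num),
        Gamma_one_half_eq]
    have := integral_one_add_sq_rpow_neg_three_halves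
    norm_num at this ⊢
    rw [this, h]
    field_simp
  | more k ih _ =>
    have h := integral_one_add_sq_rpow_neg_add_one (a := ((k : ℝ) + 2) / 2)
      (by have : (0 : ℝ) ≤ k := k.cast_nonneg
          linarith)
    rw [ih] at h
    push_cast
    rw [show ((k : ℝ) + 2 + 2) / 2 = (k + 2) / 2 + 1 by ring, h,
      show ((k : ℝ) + 2 + 1) / 2 = (k + 1) / 2 + 1 by ring,
      Gamma_add_one (by positivity), Gamma_add_one (by positivity)]
    have : Gamma (((k : ℝ) + 2) / 2) ≠ 0 := (Gamma_pos_of_pos (by positivity)).ne'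
    field_simp
    ring

/-- The normalizing constant of the density of Student's t distribution. -/
noncomputable def studentTConst (ν : ℝ) : ℝ :=
  Gamma ((ν + 1) / 2) / (√(ν * π) * Gamma (ν / 2))

/-- The unnormalized density of Student's t distribution. -/
noncomputable def studentTKernel (ν x : ℝ) : ℝ :=
  (1 + x ^ 2 / ν) ^ (-((ν + 1) / 2))

theorem studentTMeasure_eq (ν : ℝ) : studentTMeasure ν =
    volume.withDensity fun x => ENNReal.ofReal (studentTConst ν * studentTKernel ν x) := rfl

theorem studentTConst_pos {ν : ℝ} (hν : 0 < ν) : 0 < studentTConst ν := by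
  have := Gamma_pos_of_pos (show 0 < (ν + 1) / 2 by positivity)
  have := Gamma_pos_of_pos (show 0 < ν / 2 by positivity)
  unfold studentTConst
  positivity

theorem studentTKernel_nonneg {ν : ℝ} (hν : 0 < ν) (x : ℝ) : 0 ≤ studentTKernel ν x := by
  unfold studentTKernel
  positivity

theorem studentTKernel_eq {ν : ℝ} (hν : 0 < ν) (x : ℝ) :
    studentTKernel ν x = (1 + (x / √ν) ^ 2) ^ (-((ν + 1) / 2)) := by
  rw [studentTKernel, div_pow, sq_sqrt hν.le]

theorem integrable_studentTKernel {ν : ℝ} (hν : 0 < ν) : Integrable (studentTKernel ν) := by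
  have h := (integrable_one_add_sq_rpow_neg (a := (ν + 1) / 2) (by linarith)).comp_div
    (Real.sqrt_pos.mpr hν).ne'
  exact h.congr (Eventually.of_forall fun x => (studentTKernel_eq hν x).symm)

theorem integral_studentTKernel {ν : ℕ} (hν : 1 ≤ ν) :
    studentTConst ν * ∫ x, studentTKernel ν x = 1 := by
  obtain ⟨k, rfl⟩ := Nat.exists_eq_add_of_le' hν
  have hpos : (0 : ℝ) < ((k + 1 : ℕ) : ℝ) := by positivity
  simp_rw [studentTKernel_eq hpos]
  rw [Measure.integral_comp_div (fun x : ℝ => (1 + x ^ 2) ^ (-((((k + 1 : ℕ) : ℝ) + 1) / 2)))]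
  have h := integral_one_add_sq_rpow_neg_nat k
  push_cast
  rw [show (k : ℝ) + 1 + 1 = k + 2 by ring, h, studentTConst, smul_eq_mul,
    abs_of_nonneg (sqrt_nonneg _), sqrt_mul (by positivity)]
  have := Gamma_pos_of_pos (show 0 < ((k : ℝ) + 1) / 2 by positivity)
  have := Gamma_pos_of_pos (show 0 < ((k : ℝ) + 2) / 2 by positivity)
  rw [show (k : ℝ) + 1 + 1 = k + 2 by ring]
  field_simp

theorem studentTMeasure_apply {ν : ℝ} (hν : 0 < ν) {s : Set ℝ} (hs : MeasurableSet s) :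
    studentTMeasure ν s = ENNReal.ofReal (studentTConst ν * ∫ x in s, studentTKernel ν x) := by
  rw [studentTMeasure_eq, withDensity_apply _ hs, ← integral_const_mul,
    ofReal_integral_eq_lintegral_ofReal]
  · exact ((integrable_studentTKernel hν).const_mul _).integrableOn
  · exact Eventually.of_forall fun x =>
      mul_nonneg (studentTConst_pos hν).le (studentTKernel_nonneg hν x)

theorem isProbabilityMeasure_studentTMeasure {ν : ℕ} (hν : 1 ≤ ν) :
    IsProbabilityMeasure (studentTMeasure ν) := by
  constructor
  rw [studentTMeasure_apply (by exact_mod_cast hν) MeasurableSet.univ, setIntegral_univ,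
    integral_studentTKernel hν, ENNReal.ofReal_one]

theorem studentTMeasure_Iic {ν : ℕ} (hν : 1 ≤ ν) (x : ℝ) :
    (studentTMeasure ν (Set.Iic x)).toReal =
      1 - studentTConst ν * ∫ t in Set.Ioi x, studentTKernel ν t := by
  have := isProbabilityMeasure_studentTMeasure hν
  have hpos : (0 : ℝ) < ν := by exact_mod_cast hν
  have h := probReal_compl_eq_one_sub (μ := studentTMeasure ν) (measurableSet_Ioi (a := x))
  rw [Set.compl_Ioi] at h
  rw [← measureReal_def, h, measureReal_def, studentTMeasure_apply hpos measurableSet_Ioi,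
    ENNReal.toReal_ofReal]
  exact mul_nonneg (studentTConst_pos hpos).le
    (integral_nonneg fun t => studentTKernel_nonneg hpos t)

theorem hasDerivAt_neg_inv_mul_rpow {ν x : ℝ} (hν : 0 < ν) (hx : 0 < x) :
    HasDerivAt (fun x : ℝ => -(x⁻¹ * (1 + x ^ 2 / ν) ^ (-((ν - 1) / 2))))
      ((1 + (x ^ 2)⁻¹) * studentTKernel ν x) x := by
  have hp : (0 : ℝ) < 1 + x ^ 2 / ν := by positivity
  have h := ((hasDerivAt_inv hx.ne').mul
    (((((hasDerivAt_id x).pow 2).div_const ν).const_add 1).rpow_const (p := -((ν - 1) / 2))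
      (Or.inl (by simpa using hp.ne')))).neg
  convert! h using 1
  have e : (1 + x ^ 2 / ν) ^ (-((ν - 1) / 2)) =
      (1 + x ^ 2 / ν) ^ (-((ν + 1) / 2)) * (1 + x ^ 2 / ν) := by
    rw [← rpow_add_one hp.ne']; congr 1; ring
  have e2 : -((ν - 1) / 2) - 1 = -((ν + 1) / 2) := by ring
  simp [e2, studentTKernel]
  rw [e]
  field_simp
  ring

theorem tendsto_neg_inv_mul_rpow {ν : ℝ} (hν : 1 ≤ ν) :
    Tendsto (fun x : ℝ => -(x⁻¹ * (1 + x ^ 2 / ν) ^ (-((ν - 1) / 2)))) atTop (nhds 0) := by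
  refine squeeze_zero_norm' ?_ tendsto_inv_atTop_zero
  filter_upwards [eventually_gt_atTop 0] with x hx
  have h0 : 0 ≤ (1 + x ^ 2 / ν) ^ (-((ν - 1) / 2)) := by positivity
  have h1 : (1 + x ^ 2 / ν) ^ (-((ν - 1) / 2)) ≤ 1 :=
    rpow_le_one_of_one_le_of_nonpos (le_add_of_nonneg_right (by positivity)) (by linarith)
  rw [norm_neg, Real.norm_of_nonneg (by positivity)]
  exact mul_le_of_le_one_right (by positivity) h1

theorem integrableOn_Ioi_one_add_inv_sq_mul_studentTKernel {ν x : ℝ} (hν : 1 ≤ ν) (hx : 0 < x) :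
    IntegrableOn (fun t => (1 + (t ^ 2)⁻¹) * studentTKernel ν t) (Set.Ioi x) :=
  integrableOn_Ioi_deriv_of_nonneg'
    (fun t ht => hasDerivAt_neg_inv_mul_rpow (by linarith) (hx.trans_le ht))
    (fun t _ => mul_nonneg (by positivity) (studentTKernel_nonneg (by linarith) t))
    (tendsto_neg_inv_mul_rpow hν)

theorem integral_Ioi_one_add_inv_sq_mul_studentTKernel {ν x : ℝ} (hν : 1 ≤ ν) (hx : 0 < x) :
    ∫ t in Set.Ioi x, (1 + (t ^ 2)⁻¹) * studentTKernel ν t =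
      x⁻¹ * (1 + x ^ 2 / ν) ^ (-((ν - 1) / 2)) := by
  rw [integral_Ioi_of_hasDerivAt_of_nonneg'
    (fun t ht => hasDerivAt_neg_inv_mul_rpow (by linarith) (hx.trans_le ht))
    (fun t _ => mul_nonneg (by positivity) (studentTKernel_nonneg (by linarith) t))
    (tendsto_neg_inv_mul_rpow hν)]
  ring

theorem integral_Ioi_studentTKernel_le {ν x : ℝ} (hν : 1 ≤ ν) (hx : 0 < x) :
    ∫ t in Set.Ioi x, studentTKernel ν t ≤ x⁻¹ * (1 + x ^ 2 / ν) ^ (-((ν - 1) / 2)) := by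
  rw [← integral_Ioi_one_add_inv_sq_mul_studentTKernel hν hx]
  refine setIntegral_mono_on (integrable_studentTKernel (by linarith)).integrableOn
    (integrableOn_Ioi_one_add_inv_sq_mul_studentTKernel hν hx) measurableSet_Ioi fun t _ => ?_
  exact le_mul_of_one_le_left (studentTKernel_nonneg (by linarith) t)
    (le_add_of_nonneg_right (by positivity))

theorem le_integral_Ioi_studentTKernel {ν x : ℝ} (hν : 1 ≤ ν) (hx : 1 ≤ x) :
    x⁻¹ * (1 + x ^ 2 / ν) ^ (-((ν - 1) / 2)) ≤ 2 * ∫ t in Set.Ioi x, studentTKernel ν t := by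
  rw [← integral_Ioi_one_add_inv_sq_mul_studentTKernel hν (by linarith), ← integral_const_mul]
  refine setIntegral_mono_on
    (integrableOn_Ioi_one_add_inv_sq_mul_studentTKernel hν (by linarith))
    ((integrable_studentTKernel (by linarith)).const_mul 2).integrableOn
    measurableSet_Ioi fun t ht => ?_
  have h1 : (t ^ 2)⁻¹ ≤ 1 := inv_le_one_of_one_le₀ (one_le_pow₀ (hx.trans (Set.mem_Ioi.mp ht).le))
  exact mul_le_mul_of_nonneg_right (by linarith) (studentTKernel_nonneg (by linarith) t)

theorem Gamma_add_half_sq_le {s : ℝ} (hs : 0 < s) : Gamma (s + 1 / 2) ^ 2 ≤ s * Gamma s ^ 2 := by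
  have h := Gamma_mul_add_mul_le_rpow_Gamma_mul_rpow_Gamma hs (show 0 < s + 1 by linarith)
    (show (0 : ℝ) < 1 / 2 by norm_num) (show (0 : ℝ) < 1 / 2 by norm_num) (by norm_num)
  have hg := Gamma_pos_of_pos hs
  rw [show 1 / 2 * s + 1 / 2 * (s + 1) = s + 1 / 2 by ring, Gamma_add_one hs.ne',
    ← sqrt_eq_rpow, ← sqrt_eq_rpow, ← sqrt_mul hg.le] at h
  have h2 := pow_le_pow_left₀ (Gamma_pos_of_pos (by linarith : 0 < s + 1 / 2)).le h 2
  rw [sq_sqrt (by positivity)] at h2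
  linarith

theorem studentTConst_le_one {ν : ℝ} (hν : 0 < ν) : studentTConst ν ≤ 1 := by
  have h := Gamma_add_half_sq_le (show 0 < ν / 2 by positivity)
  have hg := Gamma_pos_of_pos (show 0 < ν / 2 by positivity)
  rw [show ν / 2 + 1 / 2 = (ν + 1) / 2 by ring] at h
  refine div_le_one_of_le₀ ?_ (by positivity)
  refine (sq_le_sq₀ (Gamma_pos_of_pos (by positivity)).le (by positivity)).mp ?_
  rw [mul_pow, sq_sqrt (by positivity)]
  refine h.trans ?_
  gcongr
  nlinarith [pi_gt_three]

theorem one_fourth_le_studentTConst {ν : ℝ} (hν : 1 ≤ ν) : 1 / 4 ≤ studentTConst ν := by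
  have h := Gamma_add_half_sq_le (show 0 < (ν + 1) / 2 by positivity)
  have hg := Gamma_pos_of_pos (show 0 < ν / 2 by positivity)
  have hg2 := Gamma_pos_of_pos (show 0 < (ν + 1) / 2 by positivity)
  rw [show (ν + 1) / 2 + 1 / 2 = ν / 2 + 1 by ring, Gamma_add_one (by positivity)] at h
  rw [studentTConst, le_div_iff₀ (by positivity)]
  refine (sq_le_sq₀ (by positivity) hg2.le).mp ?_
  rw [mul_pow, mul_pow, sq_sqrt (by positivity)]
  have h3 : ν / 4 * Gamma (ν / 2) ^ 2 ≤ Gamma ((ν + 1) / 2) ^ 2 := by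
    have h4 : (ν + 1) / 2 * Gamma ((ν + 1) / 2) ^ 2 ≤ ν * Gamma ((ν + 1) / 2) ^ 2 := by
      gcongr; linarith
    have h5 : ν * (ν / 4 * Gamma (ν / 2) ^ 2) ≤ ν * Gamma ((ν + 1) / 2) ^ 2 := by
      nlinarith
    exact le_of_mul_le_mul_left h5 (by linarith)
  refine le_trans ?_ h3
  rw [← mul_assoc]
  gcongr
  nlinarith [pi_lt_four]

theorem one_add_sq_div_eq_exp {ν u : ℝ} (hν : 0 < ν) (hu : 0 ≤ u) :
    1 + (√ν * √(exp u - 1)) ^ 2 / ν = exp u := by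
  rw [mul_pow, sq_sqrt hν.le, sq_sqrt (by linarith [one_le_exp hu])]
  field_simp
  ring

theorem studentT_tail_le {α ν L : ℝ} (hν : 1 ≤ ν) (hL : 0 < L) (hα : 1 ≤ α * √(2 * L)) :
    studentTConst ν * ∫ t in Set.Ioi (√ν * √(exp (2 * L / (ν - 1 / 2)) - 1)),
      studentTKernel ν t ≤ α * exp (-L) := by
  have hν' : 0 < ν - 1 / 2 := by linarith
  set s := L / (ν - 1 / 2) with hs
  have hs0 : 0 < s := by positivity
  have hLs : L = s * (ν - 1 / 2) := (div_mul_cancel₀ L hν'.ne').symm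
  rw [show 2 * L / (ν - 1 / 2) = 2 * s by rw [hs]; ring]
  set x := √ν * √(exp (2 * s) - 1) with hx
  have hexp : 0 < exp (2 * s) - 1 := by linarith [add_one_lt_exp (show 2 * s ≠ 0 by positivity)]
  have hx0 : 0 < x := by positivity
  have hα0 : 0 ≤ α := by
    by_contra! h
    nlinarith [sqrt_nonneg (2 * L)]
  have hsinh : √(2 * L) * exp (s / 2) ≤ x := by
    rw [hx, ← sqrt_mul (by linarith)]
    refine le_sqrt_of_sq_le ?_
    rw [mul_pow, sq_sqrt (by positivity), ← exp_nat_mul]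
    have h1 := self_le_sinh_iff.mpr hs0.le
    rw [sinh_eq] at h1
    have e1 : exp (2 * s) - 1 = exp s * (exp s - exp (-s)) := by
      rw [mul_sub, ← exp_add, ← exp_add, add_neg_cancel, exp_zero, two_mul]
    have e2 : ((2 : ℕ) : ℝ) * (s / 2) = s := by push_cast; ring
    rw [e1, e2]
    have h2 : 2 * L ≤ ν * (exp s - exp (-s)) := by
      have : 2 * L ≤ ν * (2 * s) := by rw [hLs]; nlinarith
      nlinarith
    nlinarith [exp_pos s]
  have hh : (1 + x ^ 2 / ν) ^ (-((ν - 1) / 2)) = exp (-L) * exp (s / 2) := by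
    rw [hx, one_add_sq_div_eq_exp (by linarith) (by positivity), ← exp_mul, ← exp_add, hLs]
    ring_nf
  have hI := integral_Ioi_studentTKernel_le hν hx0
  rw [hh] at hI
  have hI0 : 0 ≤ ∫ t in Set.Ioi x, studentTKernel ν t :=
    integral_nonneg fun t => studentTKernel_nonneg (by linarith) t
  calc _ ≤ ∫ t in Set.Ioi x, studentTKernel ν t :=
        mul_le_of_le_one_left hI0 (studentTConst_le_one (by linarith))
    _ ≤ x⁻¹ * (exp (-L) * exp (s / 2)) := hI
    _ ≤ α * exp (-L) := by
        rw [inv_mul_le_iff₀ hx0]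
        have h3 : exp (s / 2) ≤ α * x := by
          calc exp (s / 2) ≤ (α * √(2 * L)) * exp (s / 2) :=
                le_mul_of_one_le_left (exp_pos _).le hα
            _ = α * (√(2 * L) * exp (s / 2)) := by ring
            _ ≤ α * x := by gcongr
        nlinarith [exp_pos (-L)]

theorem lt_studentT_tail {α δ ν L : ℝ} (hν : 1 ≤ ν) (hδ : 0 < δ) (hδ' : δ ≤ 1 / 2) (hL : 1 ≤ L)
    (hα : α * (8 * √(2 * L)) < exp (δ * L)) :
    α * exp (-L) < studentTConst ν *
      ∫ t in Set.Ioi (√ν * √(exp ((1 - δ) * (2 * L) / ν) - 1)), studentTKernel ν t := by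
  have hν' : 0 < ν := by linarith
  have hb : 0 < 1 - δ := by linarith
  set s := (1 - δ) * L / ν with hs
  have hs0 : 0 < s := by positivity
  have hLs : (1 - δ) * L = s * ν := by rw [hs]; field_simp
  rw [show (1 - δ) * (2 * L) / ν = 2 * s by rw [hs]; ring]
  set x := √ν * √(exp (2 * s) - 1) with hx
  have hexp := add_one_le_exp (2 * s)
  have hx1 : 1 ≤ x := by
    rw [hx, ← sqrt_mul hν'.le]
    refine le_sqrt_of_sq_le ?_
    nlinarith
  have hx2 : x ≤ √(2 * L) * exp s := by
    rw [hx, ← sqrt_mul hν'.le]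
    refine sqrt_le_iff.mpr ⟨by positivity, ?_⟩
    rw [mul_pow, sq_sqrt (by positivity), ← exp_nat_mul]
    push_cast
    have h1 : exp (2 * s) - 1 ≤ 2 * s * exp (2 * s) := by
      have h2 := add_one_le_exp (-(2 * s))
      have h3 : exp (-(2 * s)) * exp (2 * s) = 1 := by rw [← exp_add]; simp
      nlinarith [exp_pos (2 * s)]
    calc ν * (exp (2 * s) - 1) ≤ ν * (2 * s * exp (2 * s)) := by gcongr
      _ = 2 * ((1 - δ) * L) * exp (2 * s) := by rw [hLs]; ring
      _ ≤ 2 * L * exp (2 * s) := by gcongr; nlinarith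
  have hh : (1 + x ^ 2 / ν) ^ (-((ν - 1) / 2)) = exp (-L) * exp (δ * L) * exp s := by
    rw [hx, one_add_sq_div_eq_exp (by linarith) (by positivity), ← exp_mul, ← exp_add, ← exp_add]
    congr 1
    linarith
  have hI := le_integral_Ioi_studentTKernel hν hx1
  rw [hh, inv_mul_le_iff₀ (by linarith)] at hI
  set I := ∫ t in Set.Ioi x, studentTKernel ν t
  have hI0 : 0 ≤ I := integral_nonneg fun t => studentTKernel_nonneg (by linarith) t
  have hI2 : exp (-L) * exp (δ * L) ≤ √(2 * L) * (2 * I) := by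
    have : exp (-L) * exp (δ * L) * exp s ≤ (√(2 * L) * (2 * I)) * exp s := by
      calc _ ≤ x * (2 * I) := hI
        _ ≤ (√(2 * L) * exp s) * (2 * I) := by gcongr
        _ = _ := by ring
    exact le_of_mul_le_mul_right this (exp_pos s)
  have hc := one_fourth_le_studentTConst hν
  have hsq : 0 < √(2 * L) := by positivity
  have h4 : (α * exp (-L)) * (8 * √(2 * L)) < (I / 4) * (8 * √(2 * L)) := by
    calc (α * exp (-L)) * (8 * √(2 * L)) = α * (8 * √(2 * L)) * exp (-L) := by ring
      _ < exp (δ * L) * exp (-L) := by gcongr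
      _ ≤ √(2 * L) * (2 * I) := by linarith
      _ = _ := by ring
  calc α * exp (-L) < I / 4 := lt_of_mul_lt_mul_right h4 (by positivity)
    _ ≤ studentTConst ν * I := by nlinarith

theorem le_quantile_and_quantile_le {μ : Measure ℝ} [IsFiniteMeasure μ] {p x y : ℝ}
    (hx : (μ (Set.Iic x)).toReal < p) (hy : p ≤ (μ (Set.Iic y)).toReal) :
    x ≤ quantile μ p ∧ quantile μ p ≤ y := by
  have hlb : ∀ z ∈ {z : ℝ | p ≤ (μ (Set.Iic z)).toReal}, x ≤ z := by
    intro z hz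
    by_contra! h
    have hm : (μ (Set.Iic z)).toReal ≤ (μ (Set.Iic x)).toReal :=
      ENNReal.toReal_mono (measure_ne_top _ _) (measure_mono (Set.Iic_subset_Iic.mpr h.le))
    exact absurd (hz.trans hm) (not_le.mpr hx)
  exact ⟨le_csInf ⟨y, hy⟩ hlb, csInf_le ⟨x, hlb⟩ hy⟩

theorem eventually_mul_sqrt_lt_exp (α : ℝ) {δ : ℝ} (hδ : 0 < δ) :
    ∀ᶠ L : ℝ in atTop, α * (8 * √(2 * L)) < exp (δ * L) := by
  have h := (isLittleO_rpow_exp_pos_mul_atTop (1 / 2) hδ).const_mul_left (α * 8 * √2)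
  filter_upwards [h.bound (show (0 : ℝ) < 1 / 2 by norm_num), eventually_ge_atTop 0] with L hL hL0
  rw [← sqrt_eq_rpow, Real.norm_eq_abs, Real.norm_eq_abs, abs_of_pos (exp_pos _)] at hL
  have := le_abs_self (α * 8 * √2 * √L)
  rw [sqrt_mul (by norm_num)]
  nlinarith [exp_pos (δ * L)]

theorem eventually_one_le_mul_sqrt {α : ℝ} (hα : 0 < α) :
    ∀ᶠ L : ℝ in atTop, 1 ≤ α * √(2 * L) :=
  ((tendsto_sqrt_atTop.comp (tendsto_id.const_mul_atTop two_pos)).const_mul_atTop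
    hα).eventually_ge_atTop 1

/-- fix `α ∈ (0,1)` and `δ > 0`.  Then there exists `M` such that for all
`m ≥ M` and every integer `n ≥ 2`:
(i) `t_{n-1}(1 - α/m) ≥ √(n-1)·(exp((1-δ)·2·log(m)/(n-1)) - 1)^{1/2}`, and
(ii) `t_{n-1}(1 - α/m) ≤ √(n-1)·(exp(2·log(m)/(n-1.5)) - 1)^{1/2}`. -/
theorem t_quantile_bounds
    (α δ : ℝ) (hα : α ∈ Set.Ioo (0 : ℝ) 1) (hδ : 0 < δ) :
    ∃ M : ℕ, ∀ m : ℕ, M ≤ m → ∀ n : ℕ, 2 ≤ n →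
      Real.sqrt ((n : ℝ) - 1) *
          Real.sqrt (Real.exp ((1 - δ) * (2 * Real.log m) / ((n : ℝ) - 1)) - 1) ≤
        tQuantile (n - 1) (1 - α / m) ∧
      tQuantile (n - 1) (1 - α / m) ≤
        Real.sqrt ((n : ℝ) - 1) *
          Real.sqrt (Real.exp (2 * Real.log m / ((n : ℝ) - 1.5)) - 1) := by
  obtain ⟨hα0, -⟩ := hα
  set d := min δ (1 / 2) with hd
  have hd0 : 0 < d := lt_min hδ (by norm_num)
  have hlog : Tendsto (fun m : ℕ => Real.log m) atTop atTop :=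
    tendsto_log_atTop.comp tendsto_natCast_atTop_atTop
  obtain ⟨M, hM⟩ := eventually_atTop.mp ((hlog.eventually ((eventually_ge_atTop 1).and
    ((eventually_one_le_mul_sqrt hα0).and (eventually_mul_sqrt_lt_exp α hd0)))).and
    (eventually_gt_atTop 0))
  refine ⟨M, fun m hm n hn => ?_⟩
  obtain ⟨⟨hL, hA, hB⟩, hm0⟩ := hM m hm
  obtain ⟨ν, rfl⟩ : ∃ ν, n = ν + 1 := ⟨n - 1, by omega⟩
  have hν : 1 ≤ ν := by omega
  have hν' : (1 : ℝ) ≤ ν := by exact_mod_cast hν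
  have := isProbabilityMeasure_studentTMeasure hν
  have e1 : ((ν + 1 : ℕ) : ℝ) - 1 = ν := by push_cast; ring
  have e2 : ((ν + 1 : ℕ) : ℝ) - 1.5 = ν - 1 / 2 := by push_cast; ring
  have e3 : α / m = α * exp (-Real.log m) := by
    rw [exp_neg, exp_log (by exact_mod_cast hm0), div_eq_mul_inv]
  rw [e1, e2, Nat.add_sub_cancel, e3]
  have h1 := lt_studentT_tail hν' hd0 (min_le_right _ _) hL hB
  have h2 := studentT_tail_le hν' (by linarith) hA
  obtain ⟨h3, h4⟩ := le_quantile_and_quantile_le (μ := studentTMeasure ν)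
    (p := 1 - α * exp (-Real.log m))
    (by rw [studentTMeasure_Iic hν]; exact sub_lt_sub_left h1 1)
    (by rw [studentTMeasure_Iic hν]; exact sub_le_sub_left h2 1)
  refine ⟨le_trans ?_ h3, h4⟩
  gcongr
  exact min_le_left _ _
end
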